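/- Let F be a (possibly unbounded) ℤ-indexed cochain complex of A-modules all of whose terms are projective, and let c : F → F be a morphism of cochain complexes such that c is chain homotopic to its square c ≫ c and c is a quasi-isomorphism (induces an isomorphism on all cohomology). Then c is chain homotopic to the identity morphism of F. (Paper's Lemma 1.7.) -/

import Mathlib

open CategoryTheory

universe u v

section Normality

open TensorProduct

theorem etale_normal {R S : Type*} [CommRing R] [IsDomain R] [IsIntegrallyClosed R]
    [CommRing S] [IsDomain S] [Algebra R S] [Algebra.Etale R S] : IsIntegrallyClosed S := by
  let K := FractionRing R
  let T := S ⊗[R] K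
  have hflat : Module.Flat R S := inferInstance
  have hinj : Function.Injective (algebraMap R S) := FaithfulSMul.algebraMap_injective R S
  have hloc : IsLocalization (Algebra.algebraMapSubmonoid S (nonZeroDivisors R)) T :=
    inferInstance
  have hle : Algebra.algebraMapSubmonoid S (nonZeroDivisors R) ≤ nonZeroDivisors S :=
    algebraMapSubmonoid_le_nonZeroDivisors_of_faithfulSMul S le_rfl
  have hdom : IsDomain T := IsLocalization.isDomain_of_le_nonZeroDivisors _ hle
  let : Algebra K T := Algebra.TensorProduct.rightAlgebra
  have : Algebra.Etale K T :=
    Algebra.Etale.of_equiv (Algebra.TensorProduct.commRight R K S)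
  have : Module.Finite K T := Algebra.FormallyUnramified.finite_of_free K T
  have hfield : IsField T := isField_of_isIntegral_of_isField' (Field.toIsField K)
  let := hfield.toField
  have hfr : IsFractionRing S T := by
    refine IsLocalization.of_le (Algebra.algebraMapSubmonoid S (nonZeroDivisors R)) _ hle ?_
    intro r hr
    refine IsUnit.mk0 _ ?_
    have := IsLocalization.injective T hle
    rw [Ne, map_eq_zero_iff _ this]
    exact nonZeroDivisors.ne_zero hr
  have hbij := TensorProduct.toIntegralClosure_bijective_of_smooth (R := R) (S := S) (B := K)
  rw [isIntegrallyClosed_iff T]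
  intro x hx
  obtain ⟨y, hy⟩ := hbij.2 ⟨x, hx⟩
  have hy' : x = (TensorProduct.toIntegralClosure R S K y : T) := by rw [hy]
  rw [hy']
  clear hy hy'
  induction y with
  | zero => exact ⟨0, by simp⟩
  | add a b ha hb =>
    obtain ⟨u, hu⟩ := ha
    obtain ⟨v, hv⟩ := hb
    exact ⟨u + v, by simp [hu, hv]⟩
  | tmul a b =>
    obtain ⟨r, hr⟩ := (isIntegrallyClosed_iff K).1 inferInstance b.2
    refine ⟨r • a, ?_⟩
    change (r • a) ⊗ₜ[R] (1 : K) = a ⊗ₜ[R] (b : K)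
    rw [← hr, smul_tmul, Algebra.algebraMap_eq_smul_one]

theorem smooth_normal {k A : Type*} [Field k] [CommRing A] [IsDomain A] [Algebra k A]
    [Algebra.FormallySmooth k A] [Algebra.FinitePresentation k A] : IsIntegrallyClosed A := by
  have : Algebra.Smooth k A := {}
  have key : ∀ p : Ideal A, p.IsPrime → ∃ f ∉ p, IsIntegrallyClosed (Localization.Away f) := by
    intro p hp
    have : Algebra.IsSmoothAt k p := inferInstance
    obtain ⟨f, hf, n, _, _, _⟩ :=
      Algebra.IsSmoothAt.exists_isStandardEtale_mvPolynomial (R := k) (p := p)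
    have hf0 : f ≠ 0 := fun h => hf (h ▸ p.zero_mem)
    have : IsDomain (Localization.Away f) :=
      IsLocalization.isDomain_localization (powers_le_nonZeroDivisors_of_noZeroDivisors hf0)
    have : Algebra.Etale (MvPolynomial (Fin n) k) (Localization.Away f) := inferInstance
    exact ⟨f, hf, etale_normal (R := MvPolynomial (Fin n) k)⟩
  rw [isIntegrallyClosed_iff (FractionRing A)]
  intro x hx
  let I : Ideal A := (1 : Submodule A (FractionRing A)).comap (LinearMap.toSpanSingleton A _ x)
  have hI : I = ⊤ := by
    by_contra h
    obtain ⟨m, hm, hle⟩ := Ideal.exists_le_maximal I h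
    obtain ⟨f, hf, hc⟩ := key m hm.isPrime
    have hf0 : f ≠ 0 := fun h => hf (h ▸ m.zero_mem)
    have hfle := powers_le_nonZeroDivisors_of_noZeroDivisors hf0
    let : Algebra (Localization.Away f) (FractionRing A) :=
      IsLocalization.localizationAlgebraOfSubmonoidLe _ _ _ _ hfle
    have : IsScalarTower A (Localization.Away f) (FractionRing A) :=
      IsLocalization.localization_isScalarTower_of_submonoid_le _ _ _ _ hfle
    have : IsFractionRing (Localization.Away f) (FractionRing A) :=
      IsFractionRing.isFractionRing_of_isDomain_of_isLocalization (Submonoid.powers f) _ _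
    obtain ⟨y, hy⟩ := (isIntegrallyClosed_iff (FractionRing A)).1 hc
      (hx.tower_top (A := Localization.Away f))
    obtain ⟨⟨a, ⟨_, n, rfl⟩⟩, ha⟩ := IsLocalization.surj (Submonoid.powers f) y
    have hmem : f ^ n ∈ I := by
      refine Submodule.mem_one.2 ⟨a, ?_⟩
      have := congrArg (algebraMap (Localization.Away f) (FractionRing A)) ha
      simp only [map_mul, ← IsScalarTower.algebraMap_apply, hy] at this
      simp [← this, Algebra.smul_def, mul_comm]
    exact hf (hm.isPrime.mem_of_pow_mem _ (hle hmem))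
  have h1 : (1 : A) ∈ I := hI ▸ Submodule.mem_top
  obtain ⟨a, ha⟩ := Submodule.mem_one.1 (show _ ∈ (1 : Submodule A (FractionRing A)) from h1)
  exact ⟨a, by simpa using ha⟩

theorem smooth_dedekind {k A : Type*} [Field k] [CommRing A] [IsDomain A] [Algebra k A]
    [Algebra.FormallySmooth k A] [Algebra.FinitePresentation k A] (hdim : ringKrullDim A = 1) :
    IsDedekindDomain A := by
  have : IsIntegrallyClosed A := smooth_normal (k := k)
  have : IsNoetherianRing A := Algebra.FiniteType.isNoetherianRing k A
  have : Ring.DimensionLEOne A := by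
    constructor
    intro p hp hpp
    obtain ⟨m, hm, hle⟩ := Ideal.exists_le_maximal p hpp.ne_top
    rcases hle.eq_or_lt with h | h
    · rwa [h]
    · exfalso
      let s : LTSeries (PrimeSpectrum A) := 
        { length := 2
          toFun := ![⟨⊥, Ideal.isPrime_bot⟩, ⟨p, hpp⟩, ⟨m, hm.isPrime⟩]
          step := by
            intro i
            fin_cases i
            · exact bot_lt_iff_ne_bot.2 hp
            · exact h }
      have := Order.LTSeries.length_le_krullDim s
      change _ ≤ ringKrullDim A at this
      rw [hdim] at this
      norm_cast at this
  exact { }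

end Normality

theorem ideal_proj {A : Type*} [CommRing A] [IsDedekindDomain A] (I : Ideal A) :
    Module.Projective A I := by
  have : Module.FinitePresentation A I := Module.finitePresentation_of_finite A I
  exact Module.Flat.projective_of_finitePresentation

theorem baer_quot {A : Type*} [CommRing A] [IsDedekindDomain A] {E Q : Type*} [AddCommGroup E]
    [AddCommGroup Q] [Module A E] [Module A Q] (hE : Module.Baer A E) (q : E →ₗ[A] Q)
    (hq : Function.Surjective q) : Module.Baer A Q := by
  intro I g
  have := ideal_proj I
  obtain ⟨g', hg'⟩ := Module.projective_lifting_property q g hq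
  obtain ⟨h, hh⟩ := hE I g'
  refine ⟨q ∘ₗ h, fun x hx => ?_⟩
  rw [LinearMap.comp_apply, hh x hx, ← hg']
  rfl

/-- sections onto submodules of projectives split -/
theorem submodule_proj {A : Type u} [CommRing A] [IsDedekindDomain A] [Small.{v} A]
    {P : Type v} [AddCommGroup P] [Module A P] [Module.Projective A P] (Z : Submodule A P) :
    Module.Projective A Z := by
  refine Module.Projective.of_lifting_property (R := A) (P := Z) ?_
  intro M N _ _ _ _ f g hf
  let E := Injective.under (ModuleCat.of A M)
  let ι : M →ₗ[A] E := (Injective.ι (ModuleCat.of A M)).hom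
  have hι : Function.Injective ι := (ModuleCat.mono_iff_injective _).1 inferInstance
  have hinj : Module.Injective A E :=
    (Module.injective_iff_injective_object A E).2 (inferInstanceAs (Injective E))
  have hE : Module.Baer A E := Module.Baer.of_injective hinj
  let K : Submodule A E := (LinearMap.ker f).map ι
  have hQ : Module.Baer A (E ⧸ K) := baer_quot hE K.mkQ K.mkQ_surjective
  let j : N →ₗ[A] E ⧸ K :=
    ((LinearMap.ker f).liftQ (K.mkQ ∘ₗ ι) (by
      intro x hx
      simp only [LinearMap.mem_ker, LinearMap.comp_apply, Submodule.mkQ_apply,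
        Submodule.Quotient.mk_eq_zero]
      exact ⟨x, hx, rfl⟩)) ∘ₗ (f.quotKerEquivOfSurjective hf).symm.toLinearMap
  have hj : ∀ m, j (f m) = K.mkQ (ι m) := by
    intro m
    have : (f.quotKerEquivOfSurjective hf).symm (f m) = (LinearMap.ker f).mkQ m := by
      rw [LinearEquiv.symm_apply_eq]; rfl
    simp only [j, LinearMap.comp_apply, LinearEquiv.coe_coe, this]
    rfl
  obtain ⟨h, hh⟩ := hQ.extension_property Z.subtype Z.injective_subtype (j ∘ₗ g)
  obtain ⟨h', hh'⟩ := Module.projective_lifting_property K.mkQ h K.mkQ_surjective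
  have hmem : ∀ z : Z, ∃ m, f m = g z ∧ ι m = h' z := by
    intro z
    obtain ⟨m, hm⟩ := hf (g z)
    have e1 : K.mkQ (h' z) = K.mkQ (ι m) := by
      rw [← hj, hm]
      have a := LinearMap.congr_fun hh z
      have b := LinearMap.congr_fun hh' (z : P)
      simp only [LinearMap.comp_apply, Submodule.subtype_apply] at a b
      rw [b, a]
    rw [← sub_eq_zero, ← map_sub, Submodule.mkQ_apply, Submodule.Quotient.mk_eq_zero] at e1
    obtain ⟨y, hy, hy'⟩ := e1
    refine ⟨m + y, ?_, ?_⟩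
    · rw [map_add, hm, LinearMap.mem_ker.1 hy, add_zero]
    · rw [map_add, hy']; abel
  let e := LinearEquiv.ofInjective ι hι
  let l : Z →ₗ[A] M := e.symm.toLinearMap ∘ₗ
    LinearMap.codRestrict (LinearMap.range ι) (h' ∘ₗ Z.subtype) (fun z => by
      obtain ⟨m, -, hm⟩ := hmem z
      exact ⟨m, hm⟩)
  refine ⟨l, ?_⟩
  ext z
  obtain ⟨m, hm1, hm2⟩ := hmem z
  have : l z = m := by
    simp only [l, LinearMap.comp_apply, LinearEquiv.coe_coe]
    rw [LinearEquiv.symm_apply_eq]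
    ext
    exact hm2.symm
  rw [LinearMap.comp_apply, this, hm1]

open CochainComplex HomComplex in
theorem contract {A : Type u} [CommRing A] [IsDedekindDomain A] [Small.{v} A]
    (P : CochainComplex (ModuleCat.{v} A) ℤ) (hP : ∀ n, Projective (P.X n)) (hac : P.Acyclic) :
    Nonempty (Homotopy (𝟙 P) 0) := by
  have hP' : ∀ n, Module.Projective A (P.X n) := fun n =>
    have := hP n
    inferInstance
  -- sections
  have hsec : ∀ n : ℤ, ∃ t : LinearMap.ker (P.d n (n+1)).hom →ₗ[A] P.X (n - 1),
      ∀ z, (P.d (n-1) n).hom (t z) = z := by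
    intro n
    have := submodule_proj (LinearMap.ker (P.d n (n+1)).hom)
    have hex : ∀ z, (P.d n (n+1)).hom z = 0 → ∃ y, (P.d (n-1) n).hom y = z := by
      intro z hz
      have h := hac n
      rw [HomologicalComplex.exactAt_iff' P (n-1) n (n+1) (by simp) (by simp)] at h
      exact (ShortComplex.moduleCat_exact_iff _).1 h z hz
    obtain ⟨t, ht⟩ := Module.projective_lifting_property
      (LinearMap.codRestrict (LinearMap.ker (P.d n (n+1)).hom) (P.d (n-1) n).hom (fun y => by
        have := P.d_comp_d (n-1) n (n+1)
        exact LinearMap.congr_fun (congrArg ModuleCat.Hom.hom this) y)) LinearMap.id (by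
        rintro ⟨z, hz⟩
        obtain ⟨y, hy⟩ := hex z hz
        exact ⟨y, Subtype.ext hy⟩)
    exact ⟨t, fun z => congrArg Subtype.val (LinearMap.congr_fun ht z)⟩
  have hsec' : ∀ m n p : ℤ, m + 1 = n → n + 1 = p →
      ∃ t : LinearMap.ker (P.d n p).hom →ₗ[A] P.X m, ∀ z, (P.d m n).hom (t z) = z := by
    rintro m n p h rfl
    obtain rfl : m = n - 1 := by lia
    exact hsec n
  -- homotopy components
  choose t ht using hsec'
  have hdd : ∀ (n p q : ℤ) (x : P.X n), (P.d p q).hom ((P.d n p).hom x) = 0 := fun n p q x =>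
    LinearMap.congr_fun (congrArg ModuleCat.Hom.hom (P.d_comp_d n p q)) x
  have hH : ∀ m n p q : ℤ, ∀ (h1 : m + 1 = n) (h2 : n + 1 = p) (h3 : p + 1 = q),
      ∃ H : P.X n →ₗ[A] P.X m, 
        ((P.d m n).hom ∘ₗ H = LinearMap.id - t n p q h2 h3 ∘ₗ
          LinearMap.codRestrict (LinearMap.ker (P.d p q).hom) (P.d n p).hom (hdd n p q)) ∧
        ∀ l, ∀ h0 : l + 1 = m, H ∘ₗ (P.d m n).hom = t m n p h1 h2 ∘ₗ
          LinearMap.codRestrict (LinearMap.ker (P.d n p).hom) (P.d m n).hom (hdd m n p) := by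
    intro m n p q h1 h2 h3
    refine ⟨t m n p h1 h2 ∘ₗ LinearMap.codRestrict (LinearMap.ker (P.d n p).hom)
      (LinearMap.id - t n p q h2 h3 ∘ₗ
          LinearMap.codRestrict (LinearMap.ker (P.d p q).hom) (P.d n p).hom (hdd n p q)) ?_,
          ?_, ?_⟩
    · intro x
      simp only [LinearMap.mem_ker, LinearMap.sub_apply, LinearMap.id_apply, map_sub,
        LinearMap.comp_apply, ht]
      exact sub_self _
    · ext x
      simp only [LinearMap.comp_apply, ht, LinearMap.codRestrict_apply]
    · intro l h0
      ext x
      simp only [LinearMap.comp_apply]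
      congr 1
      ext
      have : LinearMap.codRestrict (LinearMap.ker (P.d p q).hom) (P.d n p).hom (hdd n p q)
          ((P.d m n).hom x) = 0 := Subtype.ext (hdd m n p x)
      simp only [LinearMap.codRestrict_apply, LinearMap.sub_apply, LinearMap.comp_apply, this,
        map_zero, sub_zero, LinearMap.id_apply]
      rfl
  have hH' : ∀ m n : ℤ, ∃ H : P.X n →ₗ[A] P.X m, ∀ h1 : m + 1 = n, 
        ((P.d m n).hom ∘ₗ H = LinearMap.id - t n (n+1) (n+1+1) rfl rfl ∘ₗ
          LinearMap.codRestrict (LinearMap.ker (P.d (n+1) (n+1+1)).hom) (P.d n (n+1)).hom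
            (hdd n _ _)) ∧
        H ∘ₗ (P.d m n).hom = t m n (n+1) h1 rfl ∘ₗ
          LinearMap.codRestrict (LinearMap.ker (P.d n (n+1)).hom) (P.d m n).hom (hdd m n _) := by
    intro m n
    by_cases h : m + 1 = n
    · obtain ⟨H, a, b⟩ := hH m n (n+1) (n+1+1) h rfl rfl
      exact ⟨H, fun _ => ⟨a, b (m - 1) (by lia)⟩⟩
    · exact ⟨0, fun h' => absurd h' h⟩
  choose H h using hH'
  refine ⟨{ hom := fun i j => if j + 1 = i then ModuleCat.ofHom (H j i) else 0
            zero := fun i j hij => if_neg hij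
            comm := fun i => ?_ }⟩
  have r1 : (ComplexShape.up ℤ).Rel i (i+1) := rfl
  have r2 : (ComplexShape.up ℤ).Rel (i-1) i := by simp
  rw [dNext_eq _ r1, prevD_eq _ r2, if_pos rfl, if_pos (by lia)]
  ext x
  have e1 := LinearMap.congr_fun (h i (i+1) rfl).2 x
  have e2 := LinearMap.congr_fun (h (i-1) i (by lia)).1 x
  simp only [LinearMap.comp_apply, LinearMap.sub_apply, LinearMap.id_apply] at e1 e2
  simp [e1, e2]

theorem quasiIso_isIso {A : Type u} [CommRing A] [IsDedekindDomain A] [Small.{v} A]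
    (F : CochainComplex (ModuleCat.{v} A) ℤ) (hF : ∀ n : ℤ, Projective (F.X n))
    (c : F ⟶ F) (hqis : QuasiIso c) :
    IsIso ((HomotopyCategory.quotient _ (ComplexShape.up ℤ)).map c) := by
  have hT := HomotopyCategory.mappingCone_triangleh_distinguished c
  refine (Pretriangulated.Triangle.isZero₃_iff_isIso₁ _ hT).1 ?_
  have hac : (CochainComplex.mappingCone c).Acyclic := by
    rw [← HomotopyCategory.quotient_obj_mem_subcategoryAcyclic_iff_acyclic]
    have h1 : (HomotopyCategory.subcategoryAcyclic (ModuleCat.{v} A)).trW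
        ((HomotopyCategory.quotient _ (ComplexShape.up ℤ)).map c) := by
      rw [← HomotopyCategory.quasiIso_eq_trW_subcategoryAcyclic,
        HomotopyCategory.quotient_map_mem_quasiIso_iff]
      exact hqis
    exact (ObjectProperty.trW_iff_of_distinguished _ _ hT).1 h1
  have hproj : ∀ n, Projective ((CochainComplex.mappingCone c).X n) := by
    intro n
    have := hF (n+1)
    have := hF n
    have i : (CochainComplex.mappingCone c).X n ≅ F.X (n+1) ⊞ F.X n :=
      HomologicalComplex.homotopyCofiber.XIsoBiprod c n (n+1) rfl
    exact Projective.of_iso i.symm inferInstance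
  obtain ⟨h⟩ := contract _ hproj hac
  have := HomotopyCategory.eq_of_homotopy _ _ h
  rw [Limits.IsZero.iff_id_eq_zero]
  rw [CategoryTheory.Functor.map_id, Functor.map_zero] at this
  exact this

theorem small_or {k A : Type u} [Field k] [CommRing A] [Algebra k A] [Algebra.FiniteType k A]
    (M : Type v) [AddCommGroup M] [Module A M] [Nontrivial M] : Small.{v} A := by
  have hk : Small.{v} k := by
    obtain ⟨m, hm⟩ := exists_ne (0 : M)
    let := Module.compHom M (algebraMap k A)
    refine small_of_injective (f := fun a : k => a • m) ?_
    exact smul_left_injective k hm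
  obtain ⟨n, f, hf⟩ := (Algebra.FiniteType.iff_quotient_mvPolynomial'' (R := k) (S := A)).1
    inferInstance
  have : Small.{v} (MvPolynomial (Fin n) k) := by
    refine small_of_injective (f := fun p : MvPolynomial (Fin n) k => (MvPolynomial.map
      (Shrink.ringEquiv k).symm.toRingHom p : MvPolynomial (Fin n) (Shrink.{v} k))) ?_
    exact MvPolynomial.map_injective _ (Shrink.ringEquiv k).symm.injective
  exact small_of_surjective hf

/-- Paper's Lemma 1.7: if a chain endomorphism of a complex of projective modules
is chain homotopic to its own square and is a quasi-isomorphism, then it is chain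
homotopic to the identity. -/
theorem stmt_3 {k A : Type u} [Field k] [IsAlgClosed k] [CharZero k]
    [CommRing A] [IsDomain A] [Algebra k A]
    [Algebra.FormallySmooth k A] [Algebra.FinitePresentation k A]
    (hdim : ringKrullDim A = 1)
    (F : CochainComplex (ModuleCat.{v} A) ℤ)
    (hF : ∀ n : ℤ, Projective (F.X n))
    (c : F ⟶ F)
    (hsq : Nonempty (Homotopy c (c ≫ c)))
    (hqis : QuasiIso c) :
    Nonempty (Homotopy c (𝟙 F)) := by
  by_cases hs : Small.{v} A
  · have : IsDedekindDomain A := smooth_dedekind (k := k) hdim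
    have := quasiIso_isIso F hF c hqis
    obtain ⟨h⟩ := hsq
    refine ⟨HomotopyCategory.homotopyOfEq _ _ ?_⟩
    have e := HomotopyCategory.eq_of_homotopy _ _ h
    rw [Functor.map_comp] at e
    rw [CategoryTheory.Functor.map_id, ← cancel_mono ((HomotopyCategory.quotient _ (ComplexShape.up ℤ)).map c),
      ← e, Category.id_comp]
  · refine ⟨Homotopy.ofEq ?_⟩
    ext n x
    have : Subsingleton (F.X n) := by
      by_contra hn
      rw [not_subsingleton_iff_nontrivial] at hn
      exact hs (small_or (k := k) (F.X n))
    exact Subsingleton.elim _ _
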